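/- arXiv:1308.4230 — 4 statements merged into one kernel-verified Lean document; each statement's English description precedes it below -/
import Mathlib

section
/- If the strict attractor A of 𝒲 is path connected, then for every infinite word ϑ ∈ {1,…,N}^∞ the fractal continuation B̂(ϑ) is path connected, and the fast basin B̂ is path connected. -/
open Set Metric Filter Topology

namespace FastBasinPaper

variable {X : Type*} [MetricSpace X]

/-- The Hutchinson operator of the IFS `w`. -/
def Hutch {N : ℕ} (w : Fin N → X ≃ₜ X) (S : Set X) : Set X := ⋃ i, (w i) '' S

/-- The (large) inverse-image operation `W⁻¹ : S ↦ ⋃ᵢ wᵢ⁻¹(S)`. -/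
def HutchInv {N : ℕ} (w : Fin N → X ≃ₜ X) (S : Set X) : Set X := ⋃ i, (w i) ⁻¹' S

/-- `A` is a strict attractor of the IFS `w`: a nonempty compact set such that for some
open `U ⊇ A`, `W^k(S) → A` in the Hausdorff metric for every nonempty compact `S ⊆ U`. -/
def IsStrictAttractor {N : ℕ} (w : Fin N → X ≃ₜ X) (A : Set X) : Prop :=
  A.Nonempty ∧ IsCompact A ∧ ∃ U : Set X, IsOpen U ∧ A ⊆ U ∧
    ∀ S : Set X, S.Nonempty → IsCompact S → S ⊆ U →
      Tendsto (fun k => hausdorffDist ((Hutch w)^[k] S) A) atTop (𝓝 0)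

/-- The basin of the attractor `A`: the largest open set witnessing the attraction. -/
def AttractorBasin {N : ℕ} (w : Fin N → X ≃ₜ X) (A : Set X) : Set X :=
  ⋃₀ {U : Set X | IsOpen U ∧ A ⊆ U ∧
    ∀ S : Set X, S.Nonempty → IsCompact S → S ⊆ U →
      Tendsto (fun k => hausdorffDist ((Hutch w)^[k] S) A) atTop (𝓝 0)}

/-- The fast basin of the attractor `A`. -/
def fastBasin {N : ℕ} (w : Fin N → X ≃ₜ X) (A : Set X) : Set X :=
  {x | ∃ k : ℕ, ((Hutch w)^[k] {x} ∩ A).Nonempty}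

/-- `w_{θ₁}⁻¹ ∘ ⋯ ∘ w_{θ_k}⁻¹` (with `θ_j = θ (j-1)`). -/
def invIter {N : ℕ} (w : Fin N → X ≃ₜ X) (θ : ℕ → Fin N) : ℕ → X → X
  | 0 => id
  | k + 1 => invIter w θ k ∘ (w (θ k)).symm

/-- The fractal continuation of `A` along the infinite word `θ`:
`⋃ₖ w_{θ₁}⁻¹ ∘ ⋯ ∘ w_{θ_k}⁻¹ (A)`. -/
def continuation {N : ℕ} (w : Fin N → X ≃ₜ X) (θ : ℕ → Fin N) (A : Set X) : Set X :=
  ⋃ k, invIter w θ k '' A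

/-- `w_{θ_k} ∘ ⋯ ∘ w_{θ₁}` (with `θ_j = θ (j-1)`). -/
def revIter {N : ℕ} (w : Fin N → X ≃ₜ X) (θ : ℕ → Fin N) : ℕ → X → X
  | 0 => id
  | k + 1 => (w (θ k)) ∘ revIter w θ k

/-- `w_{θ₁} ∘ ⋯ ∘ w_{θ_k}` for a finite word `[θ₁, …, θ_k]`. -/
def wordComp {N : ℕ} (w : Fin N → X ≃ₜ X) : List (Fin N) → X → X
  | [] => id
  | i :: t => (w i) ∘ wordComp w t

/-- `w_{θ_k} ∘ ⋯ ∘ w_{θ₁}` for a finite word `[θ₁, …, θ_k]`; the set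
`(revComp w l) ⁻¹' S` is the paper's `w_{θ₁..θ_k}⁻¹(S) = {x : w_{θ_k} ∘ ⋯ ∘ w_{θ₁}(x) ∈ S}`. -/
def revComp {N : ℕ} (w : Fin N → X ≃ₜ X) : List (Fin N) → X → X
  | [] => id
  | i :: t => revComp w t ∘ (w i)

/-- The slow basin of the attractor `A`: points `x` admitting an infinite word `θ` with
`d(w_{θ_n} ∘ ⋯ ∘ w_{θ₁}(x), A) → 0`. -/
def slowBasin {N : ℕ} (w : Fin N → X ≃ₜ X) (A : Set X) : Set X :=
  {x | ∃ θ : ℕ → Fin N, Tendsto (fun n => infDist (revIter w θ n x) A) atTop (𝓝 0)}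

/-- A porous subset of a metric space. -/
def Porous (S : Set X) : Prop :=
  ∃ lam : ℝ, 0 < lam ∧ lam < 1 ∧ ∃ r₀ : ℝ, 0 < r₀ ∧ ∀ s ∈ S, ∀ r : ℝ, 0 < r → r < r₀ →
    ∃ x : X, ball x (lam * r) ⊆ ball s r \ S

/-- A σ-porous subset of a metric space: a countable union of porous sets. -/
def SigmaPorous (S : Set X) : Prop :=
  ∃ f : ℕ → Set X, (∀ n, Porous (f n)) ∧ S = ⋃ n, f n

theorem Hutch_iterate_nonempty {N : ℕ} (hN : 0 < N) (w : Fin N → X ≃ₜ X) {S : Set X}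
    (hS : S.Nonempty) (k : ℕ) : ((Hutch w)^[k] S).Nonempty := by
  induction k with
  | zero => exact hS
  | succ k ih =>
    rw [Function.iterate_succ_apply']
    obtain ⟨x, hx⟩ := ih
    exact ⟨w ⟨0, hN⟩ x, mem_iUnion.2 ⟨_, mem_image_of_mem _ hx⟩⟩

theorem Hutch_iterate_isCompact {N : ℕ} (w : Fin N → X ≃ₜ X) {S : Set X}
    (hS : IsCompact S) (k : ℕ) : IsCompact ((Hutch w)^[k] S) := by
  induction k with
  | zero => exact hS
  | succ k ih =>
    rw [Function.iterate_succ_apply']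
    exact isCompact_iUnion fun i => ih.image (w i).continuous

/-- Each map of the IFS sends a strict attractor into itself. -/
theorem IsStrictAttractor.mapsTo {N : ℕ} (hN : 0 < N) {w : Fin N → X ≃ₜ X} {A : Set X}
    (hA : IsStrictAttractor w A) (i : Fin N) : MapsTo (w i) A A := by
  obtain ⟨hne, hc, U, -, hAU, hlim⟩ := hA
  have hd := hlim A hne hc hAU
  have hfin (k : ℕ) : hausdorffEDist ((Hutch w)^[k] A) A ≠ ⊤ :=
    hausdorffEDist_ne_top_of_nonempty_of_bounded (Hutch_iterate_nonempty hN w hne k) hne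
      (Hutch_iterate_isCompact w hc k).isBounded hc.isBounded
  intro a ha
  have hex (k : ℕ) : ∃ z ∈ (Hutch w)^[k] A,
      dist z a < hausdorffDist ((Hutch w)^[k] A) A + 1 / ((k : ℝ) + 1) :=
    exists_dist_lt_of_hausdorffDist_lt' ha (lt_add_of_pos_right _ (by positivity)) (hfin k)
  choose z hz hza using hex
  have hz_lim : Tendsto z atTop (𝓝 a) :=
    tendsto_iff_dist_tendsto_zero.2 <|
      squeeze_zero (fun _ => dist_nonneg) (fun k => (hza k).le)
        (by simpa using hd.add tendsto_one_div_add_atTop_nhds_zero_nat)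
  have himage : Tendsto (fun k => infDist (w i (z k)) A) atTop (𝓝 (infDist (w i a) A)) :=
    ((continuous_infDist_pt A).tendsto _).comp (((w i).continuous.tendsto a).comp hz_lim)
  have hzero : Tendsto (fun k => infDist (w i (z k)) A) atTop (𝓝 0) := by
    refine squeeze_zero (fun _ => infDist_nonneg) (fun k => ?_)
      (hd.comp (tendsto_add_atTop_nat 1))
    refine infDist_le_hausdorffDist_of_mem ?_ (hfin (k + 1))
    rw [Function.iterate_succ_apply']
    exact mem_iUnion.2 ⟨i, mem_image_of_mem _ (hz k)⟩
  exact (hc.isClosed.mem_iff_infDist_zero hne).2 (tendsto_nhds_unique himage hzero)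

theorem invIter_congr {N : ℕ} (w : Fin N → X ≃ₜ X) {θ θ' : ℕ → Fin N} {k : ℕ}
    (h : ∀ j < k, θ j = θ' j) : invIter w θ k = invIter w θ' k := by
  induction k with
  | zero => rfl
  | succ k ih =>
    rw [invIter, invIter, ih fun j hj => h j (by omega), h k (by omega)]

theorem continuous_invIter {N : ℕ} (w : Fin N → X ≃ₜ X) (θ : ℕ → Fin N) (k : ℕ) :
    Continuous (invIter w θ k) := by
  induction k with
  | zero => exact continuous_id
  | succ k ih => exact ih.comp (w (θ k)).symm.continuous

theorem revIter_mem_Hutch_iterate {N : ℕ} (w : Fin N → X ≃ₜ X) (θ : ℕ → Fin N) (k : ℕ)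
    (x : X) : revIter w θ k x ∈ (Hutch w)^[k] {x} := by
  induction k with
  | zero => rfl
  | succ k ih =>
    rw [Function.iterate_succ_apply']
    exact mem_iUnion.2 ⟨θ k, mem_image_of_mem _ ih⟩

theorem revIter_invIter {N : ℕ} (w : Fin N → X ≃ₜ X) (θ : ℕ → Fin N) (k : ℕ) (x : X) :
    revIter w θ k (invIter w θ k x) = x := by
  induction k generalizing x with
  | zero => rfl
  | succ k ih => simp [revIter, invIter, ih]

theorem exists_invIter_eq_of_mem_Hutch_iterate {N : ℕ} (hN : 0 < N) (w : Fin N → X ≃ₜ X)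
    {k : ℕ} {x z : X} (h : z ∈ (Hutch w)^[k] {x}) : ∃ θ, invIter w θ k z = x := by
  induction k generalizing z with
  | zero => exact ⟨fun _ => ⟨0, hN⟩, h⟩
  | succ k ih =>
    rw [Function.iterate_succ_apply'] at h
    obtain ⟨i, y, hy, rfl⟩ := mem_iUnion.1 h
    obtain ⟨θ, hθ⟩ := ih hy
    refine ⟨Function.update θ k i, ?_⟩
    have hcongr : invIter w (Function.update θ k i) k = invIter w θ k :=
      invIter_congr w fun j hj => Function.update_of_ne hj.ne _ _
    simp [invIter, hcongr, hθ]

/-- The fast basin is the union of all fractal continuations. -/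
theorem fastBasin_eq_iUnion_continuation {N : ℕ} (hN : 0 < N) (w : Fin N → X ≃ₜ X)
    (A : Set X) : fastBasin w A = ⋃ θ, continuation w θ A := by
  ext x
  simp only [continuation, mem_iUnion]
  constructor
  · rintro ⟨k, z, hz, hzA⟩
    obtain ⟨θ, hθ⟩ := exists_invIter_eq_of_mem_Hutch_iterate hN w hz
    exact ⟨θ, k, z, hzA, hθ⟩
  · rintro ⟨θ, k, z, hzA, rfl⟩
    refine ⟨k, z, ?_, hzA⟩
    simpa only [revIter_invIter] using revIter_mem_Hutch_iterate w θ k (invIter w θ k z)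

theorem subset_image_invIter {N : ℕ} {w : Fin N → X ≃ₜ X} {A : Set X}
    (hA : ∀ i, MapsTo (w i) A A) (θ : ℕ → Fin N) (k : ℕ) : A ⊆ invIter w θ k '' A := by
  induction k with
  | zero => simp [invIter]
  | succ k ih =>
    refine ih.trans ?_
    rintro _ ⟨z, hz, rfl⟩
    exact ⟨w (θ k) z, hA _ hz, by simp [invIter]⟩

theorem joinedIn_continuation {N : ℕ} {w : Fin N → X ≃ₜ X} {A : Set X}
    (hA : ∀ i, MapsTo (w i) A A) (hconn : IsPathConnected A) (θ : ℕ → Fin N) {a y : X}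
    (ha : a ∈ A) (hy : y ∈ continuation w θ A) : JoinedIn (continuation w θ A) a y := by
  obtain ⟨k, hk⟩ := mem_iUnion.1 hy
  exact ((hconn.image (continuous_invIter w θ k)).joinedIn a
    (subset_image_invIter hA θ k ha) y hk).mono
      (subset_iUnion (fun k => invIter w θ k '' A) k)

/-- if the strict attractor `A` is path connected then every fractal continuation
and the fast basin are path connected. -/
theorem statement5 {X : Type*} [MetricSpace X] [CompleteSpace X] {N : ℕ} (hN : 0 < N)
    (w : Fin N → X ≃ₜ X) (A : Set X) (hA : IsStrictAttractor w A)
    (hconn : IsPathConnected A) :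
    (∀ θ : ℕ → Fin N, IsPathConnected (continuation w θ A)) ∧
    IsPathConnected (fastBasin w A) := by
  have hmaps := hA.mapsTo hN
  obtain ⟨a, ha⟩ := hconn.nonempty
  have hmem (θ : ℕ → Fin N) : a ∈ continuation w θ A := mem_iUnion.2 ⟨0, a, ha, rfl⟩
  refine ⟨fun θ => ⟨a, hmem θ, fun y hy => joinedIn_continuation hmaps hconn θ ha hy⟩, ?_⟩
  rw [fastBasin_eq_iUnion_continuation hN]
  refine ⟨a, mem_iUnion.2 ⟨fun _ => ⟨0, hN⟩, hmem _⟩, fun y hy => ?_⟩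
  obtain ⟨θ, hθ⟩ := mem_iUnion.1 hy
  exact (joinedIn_continuation hmaps hconn θ ha hθ).mono
    (subset_iUnion (fun θ => continuation w θ A) θ)
end FastBasinPaper
end

section
/- The following are equivalent: (i) B̂ ≠ A; (ii) w_i^{-1}(A) ≠ A for some i ∈ {1,…,N}; (iii) w_i(A) ≠ A for some i ∈ {1,…,N}. -/
open Set Metric Filter Topology

namespace FastBasinPaper

variable {X : Type*} [MetricSpace X]

theorem mem_hutch {X : Type*} [MetricSpace X] {N : ℕ} {w : Fin N → X ≃ₜ X} {S : Set X} {y : X} :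
    y ∈ Hutch w S ↔ ∃ i, ∃ x ∈ S, w i x = y := by
  simp [Hutch]

theorem hutch_mono {X : Type*} [MetricSpace X] {N : ℕ} (w : Fin N → X ≃ₜ X) :
    Monotone (Hutch w) :=
  fun _ _ h => iUnion_mono fun _ => image_mono h

theorem isCompact_hutch {X : Type*} [MetricSpace X] {N : ℕ} (w : Fin N → X ≃ₜ X) {S : Set X}
    (hS : IsCompact S) : IsCompact (Hutch w S) :=
  isCompact_iUnion fun i => hS.image (w i).continuous

theorem isCompact_hutch_iterate {X : Type*} [MetricSpace X] {N : ℕ} (w : Fin N → X ≃ₜ X)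
    {S : Set X} (hS : IsCompact S) (k : ℕ) : IsCompact ((Hutch w)^[k] S) := by
  induction k with
  | zero => exact hS
  | succ k ih =>
    rw [Function.iterate_succ_apply']
    exact isCompact_hutch w ih

theorem hutch_iterate_nonempty {X : Type*} [MetricSpace X] {N : ℕ} (hN : 0 < N)
    (w : Fin N → X ≃ₜ X) {S : Set X} (hS : S.Nonempty) (k : ℕ) :
    ((Hutch w)^[k] S).Nonempty := by
  induction k with
  | zero => exact hS
  | succ k ih =>
    rw [Function.iterate_succ_apply']
    obtain ⟨x, hx⟩ := ih
    exact ⟨w ⟨0, hN⟩ x, mem_hutch.2 ⟨_, x, hx, rfl⟩⟩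

/-- A strict attractor is invariant under the Hutchinson operator. -/
theorem IsStrictAttractor.hutch_eq {X : Type*} [MetricSpace X] {N : ℕ} (hN : 0 < N)
    {w : Fin N → X ≃ₜ X} {A : Set X} (hA : IsStrictAttractor w A) : Hutch w A = A := by
  obtain ⟨hne, hc, U, -, hAU, hU⟩ := hA
  have hlim := hU A hne hc hAU
  have hTne := hutch_iterate_nonempty hN w hne
  have hTc := isCompact_hutch_iterate w hc
  have hfin : ∀ k, hausdorffEDist ((Hutch w)^[k] A) A ≠ ⊤ := fun k =>
    hausdorffEDist_ne_top_of_nonempty_of_bounded (hTne k) hne (hTc k).isBounded hc.isBounded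
  have hdist : ∀ k, ∀ x ∈ A, infDist x ((Hutch w)^[k] A) ≤ hausdorffDist ((Hutch w)^[k] A) A := by
    intro k x hx
    rw [hausdorffDist_comm]
    exact infDist_le_hausdorffDist_of_mem hx (by rw [hausdorffEDist_comm]; exact hfin k)
  have hsub : Hutch w A ⊆ A := by
    intro y hy
    obtain ⟨i, x, hx, rfl⟩ := mem_hutch.1 hy
    choose u hu hux using fun k => (hTc k).exists_infDist_eq_dist (hTne k) x
    have hu_lim : Tendsto u atTop (𝓝 x) := by
      rw [tendsto_iff_dist_tendsto_zero]
      refine squeeze_zero (fun _ => dist_nonneg) (fun k => ?_) hlim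
      rw [dist_comm, ← hux k]
      exact hdist k x hx
    have hz : Tendsto (fun k => infDist (w i (u k)) A) atTop (𝓝 0) := by
      refine squeeze_zero (fun _ => infDist_nonneg) (fun k => ?_)
        (hlim.comp (tendsto_add_atTop_nat 1))
      refine infDist_le_hausdorffDist_of_mem ?_ (hfin (k + 1))
      rw [Function.iterate_succ_apply']
      exact mem_hutch.2 ⟨i, u k, hu k, rfl⟩
    have hw : Tendsto (fun k => infDist (w i (u k)) A) atTop (𝓝 (infDist (w i x) A)) :=
      (((continuous_infDist_pt A).comp (w i).continuous).tendsto x).comp hu_lim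
    exact (hc.isClosed.mem_iff_infDist_zero hne).2 (tendsto_nhds_unique hw hz)
  refine hsub.antisymm fun x hx => ?_
  have hiter : ∀ k, (Hutch w)^[k + 1] A ⊆ Hutch w A := by
    intro k
    induction k with
    | zero => exact Subset.rfl
    | succ k ih =>
      rw [Function.iterate_succ_apply']
      exact hutch_mono w (ih.trans hsub)
  refine ((isCompact_hutch w hc).isClosed.mem_iff_infDist_zero (hTne 1)).2 ?_
  refine le_antisymm (ge_of_tendsto' (hlim.comp (tendsto_add_atTop_nat 1)) fun k => ?_)
    infDist_nonneg
  exact (infDist_le_infDist_of_subset (hiter k) (hTne (k + 1))).trans (hdist (k + 1) x hx)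

theorem fastBasin_subset_of_preimage_eq {X : Type*} [MetricSpace X] {N : ℕ}
    {w : Fin N → X ≃ₜ X} {A : Set X} (h : ∀ i, (w i) ⁻¹' A = A) : fastBasin w A ⊆ A := by
  rintro x ⟨k, y, hy, hyA⟩
  induction k generalizing y with
  | zero => exact (show y = x from hy) ▸ hyA
  | succ k ih =>
    rw [Function.iterate_succ_apply'] at hy
    obtain ⟨i, z, hz, rfl⟩ := mem_hutch.1 hy
    exact ih z hz (h i ▸ hyA)

theorem subset_fastBasin {X : Type*} [MetricSpace X] {N : ℕ} (w : Fin N → X ≃ₜ X) (A : Set X) :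
    A ⊆ fastBasin w A :=
  fun x hx => ⟨0, x, rfl, hx⟩

theorem preimage_subset_fastBasin {X : Type*} [MetricSpace X] {N : ℕ} (w : Fin N → X ≃ₜ X)
    (A : Set X) (i : Fin N) : (w i) ⁻¹' A ⊆ fastBasin w A :=
  fun x hx => ⟨1, w i x, mem_hutch.2 ⟨i, x, rfl, rfl⟩, hx⟩

/-- the following are equivalent: (i) `B̂ ≠ A`; (ii) `wᵢ⁻¹(A) ≠ A` for some `i`;
(iii) `wᵢ(A) ≠ A` for some `i`. -/
theorem statement10 {X : Type*} [MetricSpace X] [CompleteSpace X] {N : ℕ} (hN : 0 < N)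
    (w : Fin N → X ≃ₜ X) (A : Set X) (hA : IsStrictAttractor w A) :
    (fastBasin w A ≠ A ↔ ∃ i, (w i) ⁻¹' A ≠ A) ∧
    ((∃ i, (w i) ⁻¹' A ≠ A) ↔ ∃ i, (w i) '' A ≠ A) := by
  refine ⟨not_iff_comm.1 ?_, exists_congr fun i => not_congr ?_⟩
  · push Not
    refine ⟨fun h => (fastBasin_subset_of_preimage_eq h).antisymm (subset_fastBasin w A),
      fun h i => ?_⟩
    refine ((preimage_subset_fastBasin w A i).trans h.subset).antisymm fun x hx => ?_
    exact (hA.hutch_eq hN).subset (mem_hutch.2 ⟨i, x, hx, rfl⟩)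
  · constructor <;> intro h
    · nth_rw 1 [← h]
      exact image_preimage_eq A (w i).surjective
    · nth_rw 1 [← h]
      exact preimage_image_eq A (w i).injective
end FastBasinPaper
end

section
/- The slow basin admits the following representations: (i) B̃ = ⋃_{k ≥ 0} W^{-k}(B(A)); (ii) there exists r_0 > 0 such that for every 0 < r < r_0, B̃ = ⋃_{k ≥ 0} W^{-k}(N_r A) = ⋃_{k ≥ 0} W^{-k}(D_r A), where N_r A = {x : d(x,A) < r} and D_r A = {x : d(x,A) ≤ r}. In particular, the slow basin B̃ is an open set. -/
open Set Metric Filter Topology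

namespace FastBasinPaper

variable {X : Type*} [MetricSpace X]

variable {N : ℕ}

theorem revIter_congr (w : Fin N → X ≃ₜ X) {θ η : ℕ → Fin N} {k : ℕ} (h : ∀ j < k, θ j = η j) :
    revIter w θ k = revIter w η k := by
  induction k with
  | zero => rfl
  | succ k ih =>
    simp only [revIter]
    rw [ih fun j hj => h j (by omega), h k (by omega)]

theorem mem_iterate_hutchInv (hN : 0 < N) (w : Fin N → X ≃ₜ X) {k : ℕ} {S : Set X} {x : X} :
    x ∈ (HutchInv w)^[k] S ↔ ∃ θ : ℕ → Fin N, revIter w θ k x ∈ S := by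
  induction k generalizing S with
  | zero => exact ⟨fun h => ⟨fun _ => ⟨0, hN⟩, h⟩, fun ⟨_, h⟩ => h⟩
  | succ k ih =>
    rw [Function.iterate_succ_apply, ih]
    constructor
    · rintro ⟨θ, h⟩
      obtain ⟨i, hi⟩ := mem_iUnion.1 h
      refine ⟨Function.update θ k i, ?_⟩
      have hθ : revIter w (Function.update θ k i) k = revIter w θ k :=
        revIter_congr w fun j hj => Function.update_of_ne hj.ne _ _
      simpa [revIter, hθ] using hi
    · rintro ⟨θ, h⟩
      exact ⟨θ, mem_iUnion.2 ⟨θ k, h⟩⟩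

theorem revIter_add_mem_iterate_hutch (w : Fin N → X ≃ₜ X) (θ : ℕ → Fin N) (k n : ℕ) (x : X) :
    revIter w θ (k + n) x ∈ (Hutch w)^[n] {revIter w θ k x} := by
  induction n with
  | zero => rfl
  | succ n ih =>
    rw [Function.iterate_succ_apply']
    exact mem_iUnion.2 ⟨θ (k + n), mem_image_of_mem _ ih⟩

theorem isCompact_iterate_hutch (w : Fin N → X ≃ₜ X) {S : Set X} (hS : IsCompact S) (n : ℕ) :
    IsCompact ((Hutch w)^[n] S) := by
  induction n with
  | zero => exact hS
  | succ n ih =>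
    rw [Function.iterate_succ_apply']
    exact isCompact_iUnion fun i => ih.image (w i).continuous

theorem isOpen_iterate_hutchInv (w : Fin N → X ≃ₜ X) {S : Set X} (hS : IsOpen S) (n : ℕ) :
    IsOpen ((HutchInv w)^[n] S) := by
  induction n with
  | zero => exact hS
  | succ n ih =>
    rw [Function.iterate_succ_apply']
    exact isOpen_iUnion fun i => ih.preimage (w i).continuous

theorem isOpen_attractorBasin (w : Fin N → X ≃ₜ X) (A : Set X) : IsOpen (AttractorBasin w A) :=
  isOpen_sUnion fun _ hU => hU.1

theorem mem_slowBasin_of_revIter_mem (w : Fin N → X ≃ₜ X) {A : Set X} (hA : IsStrictAttractor w A)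
    {θ : ℕ → Fin N} {k : ℕ} {x : X} (hx : revIter w θ k x ∈ AttractorBasin w A) :
    x ∈ slowBasin w A := by
  obtain ⟨U, ⟨-, -, hU⟩, hxU⟩ := hx
  refine ⟨θ, (tendsto_add_atTop_iff_nat k).1 ?_⟩
  refine squeeze_zero (fun _ => infDist_nonneg) (fun n => ?_)
    (hU _ (singleton_nonempty _) isCompact_singleton (singleton_subset_iff.2 hxU))
  have hmem := revIter_add_mem_iterate_hutch w θ k n x
  rw [add_comm n k]
  exact infDist_le_hausdorffDist_of_mem hmem <|
    hausdorffEDist_ne_top_of_nonempty_of_bounded ⟨_, hmem⟩ hA.1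
      (isCompact_iterate_hutch w isCompact_singleton n).isBounded hA.2.1.isBounded

/-- Any set lying between a metric neighbourhood of the attractor and its basin generates the slow
basin under inverse iteration. -/
theorem slowBasin_eq_iUnion_iterate_hutchInv (hN : 0 < N) (w : Fin N → X ≃ₜ X) {A S : Set X}
    (hA : IsStrictAttractor w A) {r : ℝ} (hr : 0 < r) (hrS : {x : X | infDist x A < r} ⊆ S)
    (hS : S ⊆ AttractorBasin w A) : slowBasin w A = ⋃ k : ℕ, (HutchInv w)^[k] S := by
  ext x
  simp only [mem_iUnion, mem_iterate_hutchInv hN]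
  constructor
  · rintro ⟨θ, hθ⟩
    obtain ⟨n, hn⟩ := (hθ.eventually_lt_const hr).exists
    exact ⟨n, θ, hrS hn⟩
  · rintro ⟨k, θ, h⟩
    exact mem_slowBasin_of_revIter_mem w hA (hS h)

theorem exists_infDist_lt_subset_attractorBasin (w : Fin N → X ≃ₜ X) {A : Set X}
    (hA : IsStrictAttractor w A) :
    ∃ r > 0, {x : X | infDist x A < r} ⊆ AttractorBasin w A := by
  obtain ⟨hne, hc, U, hU, hAU, h⟩ := hA
  obtain ⟨r, hr, hrU⟩ := hc.exists_thickening_subset_open hU hAU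
  refine ⟨r, hr, fun x hx => ⟨U, ⟨hU, hAU, h⟩, hrU ?_⟩⟩
  exact mem_thickening_iff.2 ((infDist_lt_iff hne).1 hx)

/-- representations of the slow basin:
(i) `B̃ = ⋃ₖ W⁻ᵏ(B(A))`; (ii) there is `r₀ > 0` such that for `0 < r < r₀`,
`B̃ = ⋃ₖ W⁻ᵏ(N_r A) = ⋃ₖ W⁻ᵏ(D_r A)`. In particular `B̃` is open. -/
theorem statement16 {X : Type*} [MetricSpace X] [CompleteSpace X] {N : ℕ} (hN : 0 < N)
    (w : Fin N → X ≃ₜ X) (A : Set X) (hA : IsStrictAttractor w A) :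
    slowBasin w A = ⋃ k : ℕ, (HutchInv w)^[k] (AttractorBasin w A) ∧
    (∃ r₀ > 0, ∀ r : ℝ, 0 < r → r < r₀ →
      slowBasin w A = ⋃ k : ℕ, (HutchInv w)^[k] {x : X | infDist x A < r} ∧
      slowBasin w A = ⋃ k : ℕ, (HutchInv w)^[k] {x : X | infDist x A ≤ r}) ∧
    IsOpen (slowBasin w A) := by
  obtain ⟨r₀, hr₀, hsub⟩ := exists_infDist_lt_subset_attractorBasin w hA
  have hB := slowBasin_eq_iUnion_iterate_hutchInv hN w hA hr₀ hsub Subset.rfl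
  refine ⟨hB, ⟨r₀, hr₀, fun r hr hlt => ⟨?_, ?_⟩⟩, ?_⟩
  · exact slowBasin_eq_iUnion_iterate_hutchInv hN w hA hr Subset.rfl
      fun x (hx : infDist x A < r) => hsub (hx.trans hlt)
  · exact slowBasin_eq_iUnion_iterate_hutchInv hN w hA hr
      (fun x (hx : infDist x A < r) => hx.le)
      fun x (hx : infDist x A ≤ r) => hsub (hx.trans_lt hlt)
  · rw [hB]
    exact isOpen_iUnion fun k => isOpen_iterate_hutchInv w (isOpen_attractorBasin w A) k
end FastBasinPaper
end

section
/- The r-neighbourhood N_r A = ⋃_{a ∈ A} N_r{a} of a connected set A in a metric space whose open balls are all path connected is path connected. (Key steps: a compact connected set A is ε-chainable for every ε > 0 — for each ε > 0 and a_0, a ∈ A there exist a_1,…,a_m ∈ A with d(a_{i-1}, a_i) < ε and a_m = a — and hence N_r A is a connected union of path connected balls.) -/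
open Set Metric Filter Topology

namespace FastBasinPaper

variable {X : Type*} [MetricSpace X]

/-- The end points of a chain of related elements of `A` are joined by a finite sequence in `A`
whose consecutive terms are related. -/
theorem exists_seq_of_reflTransGen {α : Type*} {R : α → α → Prop} {A : Set α} {x y : α}
    (hx : x ∈ A) (h : Relation.ReflTransGen (fun u v => v ∈ A ∧ R u v) x y) :
    ∃ (m : ℕ) (c : ℕ → α), c 0 = x ∧ c m = y ∧ (∀ i ≤ m, c i ∈ A) ∧
      ∀ i < m, R (c i) (c (i + 1)) := by
  induction h with
  | refl => exact ⟨0, fun _ => x, rfl, rfl, fun _ _ => hx, by simp⟩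
  | @tail y z _ hyz ih =>
    obtain ⟨m, c, h0, hm, hA, hR⟩ := ih
    refine ⟨m + 1, fun i => if i ≤ m then c i else z, by simp [h0], by simp, ?_, ?_⟩
    · intro i _
      dsimp only
      split_ifs with h
      · exact hA i h
      · exact hyz.1
    · intro i hi
      rcases (Nat.lt_succ_iff.mp hi).eq_or_lt with rfl | h
      · simpa [hm] using hyz.2
      · simpa [h.le, Nat.succ_le_iff.mpr h] using hR i h

/-- A preconnected subset of a metric space is `ε`-chainable for every `ε > 0`. -/
theorem reflTransGen_dist_lt_of_isPreconnected {A : Set X} (hA : IsPreconnected A) {ε : ℝ}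
    (hε : 0 < ε) {x y : X} (hx : x ∈ A) (hy : y ∈ A) :
    Relation.ReflTransGen (fun u v => v ∈ A ∧ dist u v < ε) x y := by
  refine hA.induction₂' _ (fun u hu => ?_) (fun _ _ _ _ _ _ => Relation.ReflTransGen.trans) hx hy
  filter_upwards [self_mem_nhdsWithin, mem_nhdsWithin_of_mem_nhds (ball_mem_nhds u hε)]
    with v hv hvu
  exact ⟨.single ⟨hv, mem_ball'.mp hvu⟩, .single ⟨hu, mem_ball.mp hvu⟩⟩

/-- If all open balls of radius `r` are path connected, then so is the open `r`-neighbourhood of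
a connected set. -/
theorem isPathConnected_thickening {A : Set X} (hA : IsConnected A) {r : ℝ} (hr : 0 < r)
    (hball : ∀ x : X, IsPathConnected (ball x r)) : IsPathConnected (thickening r A) := by
  have joined_of_mem_ball {a x : X} (ha : a ∈ A) (hx : x ∈ ball a r) :
      JoinedIn (thickening r A) a x :=
    ((hball a).joinedIn a (mem_ball_self hr) x hx).mono (ball_subset_thickening ha r)
  obtain ⟨a₀, ha₀⟩ := hA.nonempty
  refine ⟨a₀, self_subset_thickening hr A ha₀, fun {x} hx => ?_⟩
  obtain ⟨a, ha, hxa⟩ := mem_thickening_iff.mp hx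
  refine JoinedIn.trans ?_ (joined_of_mem_ball ha (mem_ball.mpr hxa))
  refine hA.isPreconnected.induction₂ (JoinedIn (thickening r A)) (fun u hu => ?_)
    (fun _ _ _ _ _ _ => JoinedIn.trans)
    (fun _ _ _ _ => JoinedIn.symm) ha₀ ha
  filter_upwards [mem_nhdsWithin_of_mem_nhds (ball_mem_nhds u hr)] with v hv
  exact joined_of_mem_ball hu hv

/-- in a metric space whose open balls are path connected, the open
`r`-neighbourhood of a nonempty compact connected set `A` is path connected; moreover `A`
is `ε`-chainable for every `ε > 0`. -/
theorem statement19 {X : Type*} [MetricSpace X]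
    (hball : ∀ (x : X) (r : ℝ), 0 < r → IsPathConnected (ball x r))
    (A : Set X) (hne : A.Nonempty) (hcomp : IsCompact A) (hconn : IsConnected A)
    (r : ℝ) (hr : 0 < r) :
    (∀ ε > (0 : ℝ), ∀ a₀ ∈ A, ∀ a ∈ A, ∃ (m : ℕ) (c : ℕ → X),
      c 0 = a₀ ∧ c m = a ∧ (∀ i ≤ m, c i ∈ A) ∧
      ∀ i < m, dist (c i) (c (i + 1)) < ε) ∧
    IsPathConnected {x : X | infDist x A < r} := by
  refine ⟨fun ε hε a₀ ha₀ a ha => exists_seq_of_reflTransGen ha₀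
    (reflTransGen_dist_lt_of_isPreconnected hconn.isPreconnected hε ha₀ ha), ?_⟩
  have hthick : {x : X | infDist x A < r} = thickening r A := by
    ext x
    rw [mem_ofPred_eq, infDist_lt_iff hne, mem_thickening_iff]
  rw [hthick]
  exact isPathConnected_thickening hconn hr fun x => hball x r hr
end FastBasinPaper
end
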